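/- Let X = Π_{p=1}^{n_0} X_p be a product of compact metric spaces, let M ∈ ℕ, and let s_1,…,s_{2M+1} : X → ℝ be continuous functions of the form s_q(x_1,…,x_{n_0}) = Σ_{p=1}^{n_0} ψ_{pq}(x_p) with each ψ_{pq} : X_p → [0,1] continuous, such that every continuous f : X → ℝ admits a representation f(x) = Σ_{q=1}^{2M+1} h_q(s_q(x)) for some continuous h_1,…,h_{2M+1} : ℝ → ℝ. Assume σ : ℝ → ℝ is continuous, is not an affine function, and there exist t_0 ∈ ℝ and an open neighborhood U of t_0 such that σ is differentiable on U, σ' is continuous at t_0, and σ'(t_0) ≠ 0. Set F = (s_1,…,s_{2M+1}) : X → ℝ^{2M+1}. Then for every integer m ≥ 1, every compact set K ⊆ X, every continuous function g : K → ℝ^m, and every ε > 0, there exists a deep feedforward network Φ : ℝ^{2M+1} → ℝ^m with activation σ and width at most 2M + m + 3 such that sup_{x ∈ K} ‖g(x) − Φ(F(x))‖ < ε, where ‖·‖ is the Euclidean norm on ℝ^m. -/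

import Mathlib

open scoped BigOperators

/-- Componentwise application of the activation function. -/
def applyAct (σ : ℝ → ℝ) {d : ℕ} (y : Fin d → ℝ) : Fin d → ℝ := fun i => σ (y i)

/-- `IsHiddenStack σ k n d H` means that `H : ℝⁿ → ℝᵈ` has the form
`σ ∘ T_l ∘ σ ∘ ⋯ ∘ σ ∘ T_0` where each `T_j` is affine and every hidden layer
has width at most `k`. -/
inductive IsHiddenStack (σ : ℝ → ℝ) (k n : ℕ) :
    (d : ℕ) → ((Fin n → ℝ) → (Fin d → ℝ)) → Prop
  | base {d : ℕ} (hd : d ≤ k) (A : Matrix (Fin d) (Fin n) ℝ) (b : Fin d → ℝ) :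
      IsHiddenStack σ k n d (fun x => applyAct σ (A.mulVec x - b))
  | step {d e : ℕ} (he : e ≤ k) {H : (Fin n → ℝ) → (Fin d → ℝ)}
      (hH : IsHiddenStack σ k n d H) (A : Matrix (Fin e) (Fin d) ℝ) (b : Fin e → ℝ) :
      IsHiddenStack σ k n e (fun x => applyAct σ (A.mulVec (H x) - b))

/-- `Φ : ℝⁿ → ℝᵐ` is a deep feedforward network with activation `σ` and width at
most `k`. -/
def IsDeepNet (σ : ℝ → ℝ) (k n m : ℕ) (Φ : (Fin n → ℝ) → (Fin m → ℝ)) : Prop :=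
  ∃ (d : ℕ) (H : (Fin n → ℝ) → (Fin d → ℝ)),
    IsHiddenStack σ k n d H ∧
    ∃ (A : Matrix (Fin m) (Fin d) ℝ) (b : Fin m → ℝ),
      Φ = fun x => A.mulVec (H x) - b

theorem IsDeepNet.affine_comp {σ : ℝ → ℝ} {k n d e : ℕ} {Φ : (Fin n → ℝ) → (Fin d → ℝ)}
    (hΦ : IsDeepNet σ k n d Φ) (C : Matrix (Fin e) (Fin d) ℝ) (c : Fin e → ℝ) :
    IsDeepNet σ k n e (fun x => C.mulVec (Φ x) - c) := by
  obtain ⟨r, H, hH, A, b, rfl⟩ := hΦ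
  refine ⟨r, H, hH, C * A, C.mulVec b + c, ?_⟩
  funext x
  rw [Matrix.mulVec_sub, Matrix.mulVec_mulVec, sub_sub]

theorem IsDeepNet.layer_comp {σ : ℝ → ℝ} {k n d r e : ℕ} {Φ : (Fin n → ℝ) → (Fin d → ℝ)}
    (hΦ : IsDeepNet σ k n d Φ) (hr : r ≤ k) (B : Matrix (Fin r) (Fin d) ℝ) (b : Fin r → ℝ)
    (C : Matrix (Fin e) (Fin r) ℝ) (c : Fin e → ℝ) :
    IsDeepNet σ k n e (fun x => C.mulVec (applyAct σ (B.mulVec (Φ x) - b)) - c) := by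
  obtain ⟨s, H, hH, A, a, hA⟩ := hΦ.affine_comp B b
  refine ⟨r, _, hH.step hr A a, C, c, ?_⟩
  funext x
  rw [congrFun hA x]

/-- The continuous maps realised by deep networks. -/
def netMaps (σ : ℝ → ℝ) (k n d : ℕ) : Set C(Fin n → ℝ, Fin d → ℝ) :=
  {f | IsDeepNet σ k n d f}

/-- The continuous maps that preserve locally uniform limits of deep networks under
post-composition. -/
def netOps (σ : ℝ → ℝ) (k n d : ℕ) : Set C(Fin d → ℝ, Fin d → ℝ) :=
  {T | ∀ f ∈ closure (netMaps σ k n d), T.comp f ∈ closure (netMaps σ k n d)}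

theorem isClosed_netOps (σ : ℝ → ℝ) (k n d : ℕ) : IsClosed (netOps σ k n d) := by
  simp only [netOps, Set.ofPred_forall]
  exact isClosed_biInter fun f _ => isClosed_closure.preimage (ContinuousMap.continuous_precomp f)

theorem comp_mem_netOps {σ : ℝ → ℝ} {k n d : ℕ} {S T : C(Fin d → ℝ, Fin d → ℝ)}
    (hS : S ∈ netOps σ k n d) (hT : T ∈ netOps σ k n d) : S.comp T ∈ netOps σ k n d :=
  fun f hf => hS _ (hT f hf)

theorem mem_netOps_of_mapsTo {σ : ℝ → ℝ} {k n d : ℕ} {T : C(Fin d → ℝ, Fin d → ℝ)}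
    (hT : ∀ f ∈ netMaps σ k n d, T.comp f ∈ netMaps σ k n d) : T ∈ netOps σ k n d :=
  fun _ hf => map_mem_closure (ContinuousMap.continuous_postcomp T) hf hT

/-- `v ↦ v + f (a ⬝ᵥ v) • u`. -/
def shear {d : ℕ} (f : C(ℝ, ℝ)) (a u : Fin d → ℝ) : C(Fin d → ℝ, Fin d → ℝ) where
  toFun v := v + f (a ⬝ᵥ v) • u
  continuous_toFun := by fun_prop

theorem continuous_shear {d : ℕ} (a u : Fin d → ℝ) :
    Continuous fun f : C(ℝ, ℝ) => shear f a u := by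
  refine ContinuousMap.continuous_of_continuous_uncurry _ ?_
  change Continuous fun p : C(ℝ, ℝ) × (Fin d → ℝ) => p.2 + p.1 (a ⬝ᵥ p.2) • u
  fun_prop

/-- The rescaled activation, which tends to the identity as `δ → 0`. -/
noncomputable def rescale (σ : ℝ → ℝ) (t₀ δ x : ℝ) : ℝ :=
  x * (dslope σ t₀ (t₀ + δ * x) / deriv σ t₀)

theorem continuous_dslope_of_differentiableAt {σ : ℝ → ℝ} (hσ : Continuous σ) {t₀ : ℝ}
    (hd : DifferentiableAt ℝ σ t₀) : Continuous (dslope σ t₀) := by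
  rw [continuous_iff_continuousAt]
  intro t
  by_cases h : t = t₀
  · subst h
    exact continuousAt_dslope_same.2 hd
  · exact (continuousAt_dslope_of_ne h).2 hσ.continuousAt

theorem continuous_rescale {σ : ℝ → ℝ} (hσ : Continuous σ) {t₀ : ℝ}
    (hd : DifferentiableAt ℝ σ t₀) : Continuous fun p : ℝ × ℝ => rescale σ t₀ p.1 p.2 := by
  have := continuous_dslope_of_differentiableAt hσ hd
  unfold rescale
  fun_prop

theorem rescale_zero {σ : ℝ → ℝ} {t₀ : ℝ} (h : deriv σ t₀ ≠ 0) (x : ℝ) :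
    rescale σ t₀ 0 x = x := by
  simp [rescale, dslope_same, h]

theorem rescale_of_ne_zero {σ : ℝ → ℝ} {t₀ δ : ℝ} (hδ : δ ≠ 0) (x : ℝ) :
    rescale σ t₀ δ x = (δ * deriv σ t₀)⁻¹ * σ (δ * x + t₀) - σ t₀ / (δ * deriv σ t₀) := by
  have := sub_smul_dslope σ t₀ (t₀ + δ * x)
  rw [add_sub_cancel_left, smul_eq_mul] at this
  rw [add_comm (δ * x), div_eq_inv_mul, ← mul_sub, ← this, rescale, mul_inv]
  field_simp

/-- Linear maps are limits of networks with one hidden layer. -/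
theorem mem_closure_netMaps_linear {σ : ℝ → ℝ} {k n d : ℕ} (hnk : n ≤ k) (hσ : Continuous σ)
    {t₀ : ℝ} (hd : DifferentiableAt ℝ σ t₀) (hne : deriv σ t₀ ≠ 0)
    (L : Matrix (Fin d) (Fin n) ℝ) (f : C(Fin n → ℝ, Fin d → ℝ)) (hf : ∀ x, f x = L.mulVec x) :
    f ∈ closure (netMaps σ k n d) := by
  have hr := continuous_rescale hσ hd
  let T : ℝ → C(Fin n → ℝ, Fin d → ℝ) := fun δ =>
    ⟨fun x => L.mulVec fun i => rescale σ t₀ δ (x i), by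
      have : Continuous (rescale σ t₀ δ) := hr.comp (Continuous.prodMk_right δ)
      fun_prop⟩
  have hT : Continuous T := by
    refine ContinuousMap.continuous_of_continuous_uncurry _ ?_
    change Continuous fun p : ℝ × (Fin n → ℝ) => L.mulVec fun i => rescale σ t₀ p.1 (p.2 i)
    refine Continuous.matrix_mulVec continuous_const (continuous_pi fun i => ?_)
    exact hr.comp (continuous_fst.prodMk ((continuous_apply i).comp continuous_snd))
  have h0 : T 0 = f := by
    ext x : 1
    simp only [T, ContinuousMap.coe_mk, rescale_zero hne, hf]
  rw [← h0]
  refine closure_mono ?_ (map_mem_closure hT (dense_compl_singleton (0 : ℝ) 0)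
    (Set.mapsTo_image T _))
  rintro _ ⟨δ, hδ, rfl⟩
  refine ⟨n, _, .base hnk (δ • (1 : Matrix (Fin n) (Fin n) ℝ)) (fun _ => -t₀),
    L * ((δ * deriv σ t₀)⁻¹ • (1 : Matrix (Fin n) (Fin n) ℝ)),
    L.mulVec fun _ => σ t₀ / (δ * deriv σ t₀), ?_⟩
  funext x
  rw [← Matrix.mulVec_mulVec, ← Matrix.mulVec_sub]
  change L.mulVec _ = _
  congr 1
  funext i
  simp [rescale_of_ne_zero hδ, applyAct, Matrix.smul_mulVec]

theorem shear_mem_netOps {σ : C(ℝ, ℝ)} {k n d : ℕ} (hdk : d + 1 ≤ k)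
    {t₀ : ℝ} (hd : DifferentiableAt ℝ σ t₀) (hne : deriv σ t₀ ≠ 0)
    (a u : Fin d → ℝ) (β : ℝ) (f : C(ℝ, ℝ)) (hf : ∀ t, f t = σ (t + β)) :
    shear f a u ∈ netOps σ k n d := by
  have hσ := σ.continuous
  have hr := continuous_rescale hσ hd
  let T : ℝ → C(Fin d → ℝ, Fin d → ℝ) := fun δ =>
    ⟨fun v => (fun i => rescale σ t₀ δ (v i)) + f (a ⬝ᵥ v) • u, by
      have : Continuous (rescale σ t₀ δ) := hr.comp (Continuous.prodMk_right δ)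
      fun_prop⟩
  have hT : Continuous T := by
    refine ContinuousMap.continuous_of_continuous_uncurry _ ?_
    change Continuous fun p : ℝ × (Fin d → ℝ) =>
      (fun i => rescale σ t₀ p.1 (p.2 i)) + f (a ⬝ᵥ p.2) • u
    refine Continuous.add (continuous_pi fun i => ?_) (by fun_prop)
    exact hr.comp (continuous_fst.prodMk ((continuous_apply i).comp continuous_snd))
  have h0 : T 0 = shear f a u := by
    ext x : 1
    simp only [T, ContinuousMap.coe_mk, rescale_zero hne, shear]
  rw [← h0, ← (isClosed_netOps σ k n d).closure_eq]
  refine closure_mono ?_ (map_mem_closure hT (dense_compl_singleton (0 : ℝ) 0)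
    (Set.mapsTo_image T _))
  rintro _ ⟨δ, hδ, rfl⟩
  refine mem_netOps_of_mapsTo fun g hg => ?_
  let B : Matrix (Fin (d + 1)) (Fin d) ℝ :=
    Matrix.of (Fin.snoc (α := fun _ => Fin d → ℝ)
      (fun i => δ • (Pi.single i 1 : Fin d → ℝ)) a)
  let b : Fin (d + 1) → ℝ := Fin.snoc (α := fun _ => ℝ) (fun _ => -t₀) (-β)
  let C : Matrix (Fin d) (Fin (d + 1)) ℝ :=
    Matrix.of fun i => Fin.snoc (α := fun _ => ℝ) (Pi.single i (δ * deriv σ t₀)⁻¹) (u i)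
  have key := IsDeepNet.layer_comp hg hdk B b C (fun _ => σ t₀ / (δ * deriv σ t₀))
  change IsDeepNet σ k n d _
  convert key using 1
  funext x i
  have h1 (j : Fin d) : (B.mulVec (g x) - b) j.castSucc = δ * g x j + t₀ := by
    have hB : B j.castSucc = δ • Pi.single j 1 :=
      Fin.snoc_castSucc (α := fun _ => Fin d → ℝ) a
        (fun i => δ • (Pi.single i 1 : Fin d → ℝ)) j
    rw [Pi.sub_apply, Matrix.mulVec, hB, smul_dotProduct, single_one_dotProduct]
    simp [b]
  have h2 : (B.mulVec (g x) - b) (Fin.last d) = a ⬝ᵥ g x + β := by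
    simp [B, b, Matrix.mulVec]
  have h3 : C.mulVec (applyAct σ (B.mulVec (g x) - b)) i
      = (δ * deriv σ t₀)⁻¹ * σ (δ * g x i + t₀) + u i * σ (a ⬝ᵥ g x + β) := by
    rw [Matrix.mulVec, dotProduct, Fin.sum_univ_castSucc]
    simp only [applyAct, h1, h2]
    simp [C, Pi.single_apply]
  rw [Pi.sub_apply, h3]
  simp only [T, ContinuousMap.comp_apply, ContinuousMap.coe_mk, Pi.add_apply, Pi.smul_apply,
    smul_eq_mul, rescale_of_ne_zero hδ, hf]
  ring

theorem mem_closure_iff_forall_isCompact {X E : Type*} [TopologicalSpace X] [PseudoMetricSpace E]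
    {S : Set C(X, E)} {f : C(X, E)} :
    f ∈ closure S ↔ ∀ K : Set X, IsCompact K → ∀ ε > 0, ∃ g ∈ S, ∀ x ∈ K, dist (f x) (g x) < ε := by
  have hb := nhds_basis_uniformity'
    (Metric.uniformity_basis_dist (α := E)).compactConvergenceUniformity (x := f)
  rw [mem_closure_iff_nhds_basis hb]
  constructor
  · intro h K hK ε hε
    exact h (K, ε) ⟨hK, hε⟩
  · rintro h ⟨K, ε⟩ ⟨hK, hε⟩
    exact h K hK ε hε

theorem Submodule.mem_of_eq_integral {S : Submodule ℝ C(ℝ, ℝ)} (hS : IsClosed (S : Set C(ℝ, ℝ)))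
    (G : C(ℝ, C(ℝ, ℝ))) (hG : ∀ t, G t ∈ S) (a : ℝ) (f : C(ℝ, ℝ))
    (hf : ∀ x, f x = ∫ t in Set.Icc a (a + 1), G t x) : f ∈ S := by
  rw [← SetLike.mem_coe, ← hS.closure_eq, mem_closure_iff_forall_isCompact]
  intro K hK ε hε
  have : CompactSpace K := isCompact_iff_compactSpace.1 hK
  let R : C(ℝ, ℝ) →ₗ[ℝ] C(K, ℝ) :=
    { toFun := fun g => g.restrict K, map_add' := fun _ _ => rfl, map_smul' := fun _ _ => rfl }
  have hR : Continuous fun t => R (G t) := (ContinuousMap.continuous_restrict K).comp G.continuous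
  have hint : MeasureTheory.IntegrableOn (fun t => R (G t)) (Set.Icc a (a + 1)) :=
    hR.continuousOn.integrableOn_compact isCompact_Icc
  have : MeasureTheory.IsProbabilityMeasure
      (MeasureTheory.volume.restrict (Set.Icc a (a + 1))) := ⟨by simp⟩
  have hmem : ∫ t in Set.Icc a (a + 1), R (G t) ∈ closure (S.map R : Set C(K, ℝ)) :=
    (S.map R).convex.closure.integral_mem isClosed_closure
      (.of_forall fun t => subset_closure ⟨_, hG t, rfl⟩) hint
  obtain ⟨_, ⟨g, hg, rfl⟩, hd⟩ := Metric.mem_closure_iff.1 hmem ε hε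
  refine ⟨g, hg, fun x hx => ?_⟩
  have h := (ContinuousMap.dist_lt_iff hε).1 hd ⟨x, hx⟩
  rw [ContinuousMap.integral_apply hint] at h
  rw [hf]
  exact h

theorem Submodule.pow_mul_deriv_mem {S : Submodule ℝ C(ℝ, ℝ)} (hS : IsClosed (S : Set C(ℝ, ℝ)))
    {f : ℝ → ℝ} (hf : ContDiff ℝ 1 f) (k : ℕ)
    (h : ∀ a b, ∀ F : C(ℝ, ℝ), (∀ x, F x = x ^ k * f (a * x + b)) → F ∈ S)
    (a b : ℝ) (F : C(ℝ, ℝ)) (hF : ∀ x, F x = x ^ (k + 1) * deriv f (a * x + b)) : F ∈ S := by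
  have hf' : Continuous (deriv f) := hf.continuous_deriv le_rfl
  have hJ : Continuous fun p : ℝ × ℝ =>
      p.2 ^ (k + 1) * ∫ t in (0 : ℝ)..1, deriv f (a * p.2 + b + t * (p.1 * p.2)) := by
    refine Continuous.mul (by fun_prop) ?_
    refine intervalIntegral.continuous_parametric_intervalIntegral_of_continuous' ?_ 0 1
    simp only [Function.uncurry_def]
    fun_prop
  let T : C(ℝ, C(ℝ, ℝ)) := ContinuousMap.curry ⟨_, hJ⟩
  have h0 : T 0 = F := by
    ext x
    simp [T, hF]
  rw [← h0, ← SetLike.mem_coe, ← hS.closure_eq]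
  refine closure_mono ?_ (map_mem_closure T.continuous (dense_compl_singleton (0 : ℝ) 0)
    (Set.mapsTo_image T _))
  rintro _ ⟨δ, hδ : δ ≠ 0, rfl⟩
  have hc := hf.continuous
  have key : T δ = δ⁻¹ • ((⟨fun x => x ^ k * f ((a + δ) * x + b), by fun_prop⟩ : C(ℝ, ℝ))
      - ⟨fun x => x ^ k * f (a * x + b), by fun_prop⟩) := by
    ext x
    have hI : ∫ t in (0 : ℝ)..1, deriv f (a * x + b + t * (δ * x)) * (δ * x)
        = f ((a + δ) * x + b) - f (a * x + b) := by
      rw [intervalIntegral.integral_eq_sub_of_hasDerivAt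
        (f := fun t => f (a * x + b + t * (δ * x)))]
      · congr 2 <;> ring
      · intro t _
        have h1 : HasDerivAt (fun t => a * x + b + t * (δ * x)) (δ * x) t := by
          simpa using ((hasDerivAt_id t).mul_const (δ * x)).const_add (a * x + b)
        exact ((hf.differentiable one_ne_zero _).hasDerivAt).comp t h1
      · exact Continuous.intervalIntegrable (by fun_prop) _ _
    rw [intervalIntegral.integral_mul_const] at hI
    simp only [T, ContinuousMap.curry_apply, ContinuousMap.coe_mk, ContinuousMap.smul_apply,
      ContinuousMap.sub_apply, smul_eq_mul, ← mul_sub, ← hI]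
    generalize ∫ t in (0 : ℝ)..1, deriv f (a * x + b + t * (δ * x)) = I
    field_simp
    ring
  rw [key]
  exact S.smul_mem _ (S.sub_mem (h _ _ _ fun _ => rfl) (h _ _ _ fun _ => rfl))

theorem eq_affine_of_deriv_deriv_eq_zero {g : ℝ → ℝ} (hg : ContDiff ℝ 2 g)
    (h : ∀ x, deriv (deriv g) x = 0) (x : ℝ) : g x = g 0 + (g 1 - g 0) * x := by
  have hd : Differentiable ℝ g := hg.differentiable two_ne_zero
  have hd' : Differentiable ℝ (deriv g) :=
    (hg.iterate_deriv' 1 1).differentiable one_ne_zero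
  have h1 (y : ℝ) : deriv g y = deriv g 0 := is_const_of_deriv_eq_zero hd' h y 0
  have h2 (y : ℝ) : g y - deriv g 0 * y = g 0 - deriv g 0 * 0 := by
    refine is_const_of_deriv_eq_zero (f := fun y => g y - deriv g 0 * y) (by fun_prop) ?_ y 0
    intro z
    have := (hd z).hasDerivAt.sub ((hasDerivAt_id z).const_mul (deriv g 0))
    exact this.deriv.trans (by simp [h1 z])
  linear_combination h2 x - x * h2 1

/-- A closed subspace of `C(ℝ, ℝ)` containing all dilated translates of a function that is not
affine contains the square function. -/
theorem Submodule.sq_mem_of_not_affine {S : Submodule ℝ C(ℝ, ℝ)} (hS : IsClosed (S : Set C(ℝ, ℝ)))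
    (σ : C(ℝ, ℝ)) (hna : ¬ ∃ a b : ℝ, ∀ t, σ t = a * t + b)
    (h : ∀ a b, ∀ F : C(ℝ, ℝ), (∀ x, F x = σ (a * x + b)) → F ∈ S)
    (F : C(ℝ, ℝ)) (hF : ∀ x, F x = x ^ 2) : F ∈ S := by
  by_contra hcon
  let φ : ℕ → ContDiffBump (0 : ℝ) := fun n =>
    ⟨(1 / 4) * (1 / (n + 1)), (1 / 2) * (1 / (n + 1)), by positivity, by
      have : (0 : ℝ) < 1 / (n + 1) := by positivity
      linarith⟩
  let g : ℕ → ℝ → ℝ := fun n =>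
    MeasureTheory.convolution ((φ n).normed MeasureTheory.volume) σ (ContinuousLinearMap.lsmul ℝ ℝ)
      MeasureTheory.volume
  have hsmooth (n : ℕ) : ContDiff ℝ 2 (g n) :=
    (φ n).hasCompactSupport_normed.contDiff_convolution_left _ (φ n).contDiff_normed
      σ.continuous.locallyIntegrable
  have hgS (n : ℕ) (a b : ℝ) (G : C(ℝ, ℝ)) (hG : ∀ x, G x = x ^ 0 * g n (a * x + b)) : G ∈ S := by
    have hcont : Continuous fun p : ℝ × ℝ =>
        (φ n).normed MeasureTheory.volume p.1 * σ (a * p.2 + b - p.1) := by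
      have := (φ n).continuous_normed (μ := MeasureTheory.volume)
      fun_prop
    refine mem_of_eq_integral hS (ContinuousMap.curry ⟨_, hcont⟩) (fun t => ?_) (-(1 / 2)) G ?_
    · have : ContinuousMap.curry ⟨_, hcont⟩ t = (φ n).normed MeasureTheory.volume t •
          (⟨fun x => σ (a * x + (b - t)), by fun_prop⟩ : C(ℝ, ℝ)) := by
        ext x
        simp [add_sub_assoc]
      rw [this]
      exact S.smul_mem _ (h a (b - t) _ fun _ => rfl)
    · intro x
      rw [hG, pow_zero, one_mul]
      symm
      refine MeasureTheory.setIntegral_eq_integral_of_forall_compl_eq_zero fun t ht => ?_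
      have ht' : t ∉ Function.support ((φ n).normed MeasureTheory.volume) := by
        rw [ContDiffBump.support_normed_eq, mem_ball_zero_iff, not_lt]
        have h1 : (1 : ℝ) / (n + 1) ≤ 1 := by
          rw [div_le_one (by positivity)]
          linarith [(Nat.cast_nonneg n : (0 : ℝ) ≤ n)]
        have h2 : 1 / 2 < ‖t‖ := by
          by_contra! hle
          rw [Real.norm_eq_abs, abs_le] at hle
          exact ht ⟨hle.1, by linarith [hle.2]⟩
        change (1 / 2 : ℝ) * (1 / (n + 1)) ≤ _
        linarith
      simp [Function.notMem_support.1 ht']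
  have hz (n : ℕ) (b : ℝ) : deriv (deriv (g n)) b = 0 := by
    by_contra hne
    refine hcon ?_
    have hg' : ContDiff ℝ 1 (deriv (g n)) := (hsmooth n).iterate_deriv' 1 1
    have h2 := pow_mul_deriv_mem hS hg' 1
      (pow_mul_deriv_mem hS ((hsmooth n).of_le one_le_two) 0 (hgS n)) 0 b
      (deriv (deriv (g n)) b • F) (fun x => by simp [hF, mul_comm])
    simpa [hne] using S.smul_mem (deriv (deriv (g n)) b)⁻¹ h2
  have hlim (x : ℝ) : Filter.Tendsto (fun n => g n x) Filter.atTop (nhds (σ x)) := by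
    refine ContDiffBump.convolution_tendsto_right_of_continuous ?_ σ.continuous x
    simpa [φ] using tendsto_one_div_add_atTop_nhds_zero_nat.const_mul (1 / 2 : ℝ)
  refine hna ⟨σ 1 - σ 0, σ 0, fun t => ?_⟩
  have := tendsto_nhds_unique (hlim t) (((hlim 0).add (((hlim 1).sub (hlim 0)).mul_const t)).congr
    fun n => (eq_affine_of_deriv_deriv_eq_zero (hsmooth n) (hz n) t).symm)
  linarith

theorem shear_one_mem_netOps (σ : ℝ → ℝ) (k n : ℕ) {d : ℕ} (a u : Fin d → ℝ) :
    shear 1 a u ∈ netOps σ k n d := by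
  refine mem_netOps_of_mapsTo fun f hf => ?_
  have h := IsDeepNet.affine_comp hf 1 (-u)
  change IsDeepNet σ k n d _
  convert h using 1
  funext x
  simp [shear]

/-- The functions `f` for which all shears `v ↦ v + c * f (a ⬝ᵥ v) • u` are limits of networks. -/
def shearSubmodule (σ : ℝ → ℝ) (k n : ℕ) {d : ℕ} (a u : Fin d → ℝ) (hau : a ⬝ᵥ u = 0) :
    Submodule ℝ C(ℝ, ℝ) where
  carrier := {f | ∀ c : ℝ, shear f a (c • u) ∈ netOps σ k n d}
  zero_mem' c := by
    convert shear_one_mem_netOps σ k n a 0 using 1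
    ext v i
    simp [shear]
  add_mem' {f g} hf hg c := by
    convert comp_mem_netOps (hf c) (hg c) using 1
    ext v i
    simp [shear, hau]
    ring
  smul_mem' r f hf c := by
    convert hf (c * r) using 1
    ext v i
    simp [shear]
    ring

theorem isClosed_shearSubmodule (σ : ℝ → ℝ) (k n : ℕ) {d : ℕ} (a u : Fin d → ℝ)
    (hau : a ⬝ᵥ u = 0) : IsClosed (shearSubmodule σ k n a u hau : Set C(ℝ, ℝ)) := by
  change IsClosed {f : C(ℝ, ℝ) | ∀ c : ℝ, shear f a (c • u) ∈ netOps σ k n d}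
  simp only [Set.ofPred_forall]
  exact isClosed_iInter fun c => (isClosed_netOps σ k n d).preimage (continuous_shear a (c • u))

theorem sq_mem_shearSubmodule {σ : C(ℝ, ℝ)} (hna : ¬ ∃ a b : ℝ, ∀ t, σ t = a * t + b)
    {t₀ : ℝ} (hd : DifferentiableAt ℝ σ t₀) (hne : deriv σ t₀ ≠ 0) {k n d : ℕ} (hdk : d + 1 ≤ k)
    (a u : Fin d → ℝ) (hau : a ⬝ᵥ u = 0) (F : C(ℝ, ℝ)) (hF : ∀ x, F x = x ^ 2) :
    F ∈ shearSubmodule σ k n a u hau := by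
  refine Submodule.sq_mem_of_not_affine (isClosed_shearSubmodule _ _ _ _ _ _) σ hna ?_ F hF
  intro α β G hG c
  convert shear_mem_netOps hdk hd hne (α • a) (c • u) β
    ⟨fun t => σ (t + β), by fun_prop⟩ (fun _ => rfl) using 1
  ext v i
  simp [shear, hG]

theorem mul_mem_netOps {σ : C(ℝ, ℝ)} (hna : ¬ ∃ a b : ℝ, ∀ t, σ t = a * t + b)
    {t₀ : ℝ} (hd : DifferentiableAt ℝ σ t₀) (hne : deriv σ t₀ ≠ 0) {k n d : ℕ} (hdk : d + 1 ≤ k)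
    {i r j : Fin d} (hij : i ≠ j) (hrj : r ≠ j) (c : ℝ) (P : C(Fin d → ℝ, Fin d → ℝ))
    (hP : ∀ v, P v = v + (c * (v i * v r)) • Pi.single j 1) : P ∈ netOps σ k n d := by
  let sq : C(ℝ, ℝ) := ⟨fun x => x ^ 2, by fun_prop⟩
  have h (s : ℝ) : ((Pi.single i 1 + s • Pi.single r 1 : Fin d → ℝ)) ⬝ᵥ Pi.single j 1 = 0 := by
    simp [hij.symm, hrj.symm]
  convert comp_mem_netOps
    (sq_mem_shearSubmodule (n := n) hna hd hne hdk _ _ (h 1) sq (fun _ => rfl) (c / 4))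
    (sq_mem_shearSubmodule (n := n) hna hd hne hdk _ _ (h (-1)) sq (fun _ => rfl) (-(c / 4)))
    using 1
  ext v l
  simp [shear, hP, sq, add_dotProduct, hij, hrj]
  ring

theorem id_mul_mem_shearSubmodule {σ : C(ℝ, ℝ)} (hna : ¬ ∃ a b : ℝ, ∀ t, σ t = a * t + b)
    {t₀ : ℝ} (hd : DifferentiableAt ℝ σ t₀) (hne : deriv σ t₀ ≠ 0) {k n d : ℕ} (hdk : d + 1 ≤ k)
    {i r j : Fin d} (hir : i ≠ r) (hij : i ≠ j) (hrj : r ≠ j)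
    (h₁ : (Pi.single i 1 : Fin d → ℝ) ⬝ᵥ Pi.single r 1 = 0)
    (h₂ : (Pi.single i 1 : Fin d → ℝ) ⬝ᵥ Pi.single j 1 = 0) {f : C(ℝ, ℝ)}
    (hf : f ∈ shearSubmodule σ k n _ _ h₁) :
    ContinuousMap.id ℝ * f ∈ shearSubmodule σ k n _ _ h₂ := by
  intro c
  let P : ℝ → C(Fin d → ℝ, Fin d → ℝ) := fun c =>
    ⟨fun v => v + (c * (v i * v r)) • Pi.single j 1, by fun_prop⟩
  have hP (c : ℝ) : P c ∈ netOps σ k n d :=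
    mul_mem_netOps hna hd hne hdk hij hrj c (P c) fun _ => rfl
  convert comp_mem_netOps (hP (-c)) (comp_mem_netOps (hf (-1))
    (comp_mem_netOps (hP c) (hf 1))) using 1
  ext v l
  simp [shear, P, hij, hrj, hir]
  ring

theorem shearSubmodule_eq_top {σ : C(ℝ, ℝ)} (hna : ¬ ∃ a b : ℝ, ∀ t, σ t = a * t + b)
    {t₀ : ℝ} (hd : DifferentiableAt ℝ σ t₀) (hne : deriv σ t₀ ≠ 0) {k n d : ℕ} (hdk : d + 1 ≤ k)
    (hd3 : 3 ≤ d) {i j : Fin d} (hij : i ≠ j)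
    (h : (Pi.single i 1 : Fin d → ℝ) ⬝ᵥ Pi.single j 1 = 0) :
    shearSubmodule σ k n _ _ h = ⊤ := by
  have hpow (e : ℕ) : ∀ {j : Fin d} (hij : i ≠ j)
      (h : (Pi.single i 1 : Fin d → ℝ) ⬝ᵥ Pi.single j 1 = 0),
      ContinuousMap.id ℝ ^ e ∈ shearSubmodule σ k n _ _ h := by
    induction e with
    | zero => exact fun _ _ c => shear_one_mem_netOps σ k n _ _
    | succ e ih =>
      intro j hij h
      obtain ⟨r, hr⟩ : ∃ r, r ∉ ({i, j} : Finset (Fin d)) := by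
        by_contra! hall
        have := Finset.card_le_card (fun r _ => hall r : Finset.univ ⊆ ({i, j} : Finset (Fin d)))
        have := this.trans Finset.card_le_two
        simp at this
        omega
      simp only [Finset.mem_insert, Finset.mem_singleton, not_or] at hr
      rw [pow_succ']
      exact id_mul_mem_shearSubmodule hna hd hne hdk (Ne.symm hr.1) hij hr.2
        (by simp [hr.1]) h (ih (Ne.symm hr.1) _)
  have hpoly (p : Polynomial ℝ) : p.toContinuousMap ∈ shearSubmodule σ k n _ _ h := by
    have : p.toContinuousMap = ∑ e ∈ p.support, p.coeff e • ContinuousMap.id ℝ ^ e := by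
      ext x
      simp [Polynomial.eval_eq_sum, Polynomial.sum_def]
    rw [this]
    exact Submodule.sum_mem _ fun e _ => Submodule.smul_mem _ _ (hpow e hij h)
  rw [eq_top_iff]
  intro f _
  rw [← SetLike.mem_coe, ← (isClosed_shearSubmodule _ _ _ _ _ _).closure_eq,
    mem_closure_iff_forall_isCompact]
  intro K hK ε hε
  obtain ⟨R, hR⟩ := hK.isBounded.subset_closedBall 0
  rw [Real.closedBall_eq_Icc] at hR
  obtain ⟨p, hp⟩ := exists_polynomial_near_of_continuousOn _ _ f f.continuous.continuousOn ε hε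
  refine ⟨_, hpoly p, fun x hx => ?_⟩
  rw [dist_comm, Real.dist_eq]
  exact hp x (hR hx)

theorem sum_shear_mem_netOps {σ : C(ℝ, ℝ)} (hna : ¬ ∃ a b : ℝ, ∀ t, σ t = a * t + b)
    {t₀ : ℝ} (hd : DifferentiableAt ℝ σ t₀) (hne : deriv σ t₀ ≠ 0) {k n d : ℕ} (hdk : d + 1 ≤ k)
    (hd3 : 3 ≤ d) {ι κ : Type*} (i : ι → Fin d) (j : κ → Fin d) (hij : ∀ q p, i q ≠ j p)
    (f : ι → κ → C(ℝ, ℝ)) (s : Finset (ι × κ)) (P : C(Fin d → ℝ, Fin d → ℝ))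
    (hP : ∀ v, P v = v + ∑ x ∈ s, f x.1 x.2 (v (i x.1)) • Pi.single (j x.2) 1) :
    P ∈ netOps σ k n d := by
  classical
  induction s using Finset.induction_on generalizing P with
  | empty =>
    convert shear_one_mem_netOps σ k n 0 0 using 1
    ext v l
    simp [hP, shear]
  | insert x s hx ih =>
    have h : (Pi.single (i x.1) 1 : Fin d → ℝ) ⬝ᵥ Pi.single (j x.2) 1 = 0 := by
      simp [(hij x.1 x.2).symm]
    have hmem : f x.1 x.2 ∈ shearSubmodule σ k n _ _ h := by
      rw [shearSubmodule_eq_top hna hd hne hdk hd3 (hij _ _)]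
      trivial
    convert comp_mem_netOps (hmem 1) (ih
      ⟨fun v => v + ∑ x ∈ s, f x.1 x.2 (v (i x.1)) • Pi.single (j x.2) 1, by fun_prop⟩
      fun _ => rfl) using 1
    ext v l
    have h0 : ∑ y ∈ s, f y.1 y.2 (v (i y.1)) * (Pi.single (j y.2) 1 : Fin d → ℝ) (i x.1) = 0 :=
      Finset.sum_eq_zero fun y _ => by simp [hij]
    simp [hP, shear, Finset.sum_insert hx, h0]
    ring

/-- Sums of univariate continuous functions are limits of deep narrow networks. -/
theorem sum_mem_closure_netMaps {σ : C(ℝ, ℝ)} (hna : ¬ ∃ a b : ℝ, ∀ t, σ t = a * t + b)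
    {t₀ : ℝ} (hd : DifferentiableAt ℝ σ t₀) (hne : deriv σ t₀ ≠ 0) {n m : ℕ} (hn : 1 ≤ n)
    (hm : 1 ≤ m) (f : Fin n → Fin m → C(ℝ, ℝ)) (G : C(Fin n → ℝ, Fin m → ℝ))
    (hG : ∀ x p, G x p = ∑ q, f q p (x q)) : G ∈ closure (netMaps σ (n + m + 2) n m) := by
  let i : Fin n → Fin (n + m + 1) := fun q => (q.castAdd m).castSucc
  let j : Fin m → Fin (n + m + 1) := fun p => (p.natAdd n).castSucc
  have hij (q p) : i q ≠ j p := by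
    simp only [i, j, ne_eq, Fin.ext_iff, Fin.val_castSucc, Fin.val_castAdd, Fin.val_natAdd]
    omega
  have hi : Function.Injective i := fun _ _ h =>
    Fin.castAdd_injective _ _ (Fin.castSucc_injective _ h)
  have hj : Function.Injective j := fun _ _ h =>
    Fin.natAdd_injective _ _ (Fin.castSucc_injective _ h)
  let A : Matrix (Fin (n + m + 1)) (Fin n) ℝ := Matrix.of fun l q => (Pi.single (i q) 1 : _ → ℝ) l
  let B : Matrix (Fin m) (Fin (n + m + 1)) ℝ := Matrix.of fun p => Pi.single (j p) 1
  let T : C(Fin (n + m + 1) → ℝ, Fin (n + m + 1) → ℝ) :=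
    ⟨fun v => v + ∑ x : Fin n × Fin m, f x.1 x.2 (v (i x.1)) • Pi.single (j x.2) 1, by fun_prop⟩
  have hT : T ∈ netOps σ (n + m + 2) n (n + m + 1) :=
    sum_shear_mem_netOps hna hd hne le_rfl (by omega) i j hij f Finset.univ T fun _ => rfl
  have h1 := hT _ (mem_closure_netMaps_linear (k := n + m + 2) (by omega) σ.continuous hd hne A
    ⟨A.mulVec, by fun_prop⟩ fun _ => rfl)
  let L : C(Fin (n + m + 1) → ℝ, Fin m → ℝ) := ⟨B.mulVec, by fun_prop⟩
  have h2 := map_mem_closure (t := netMaps σ (n + m + 2) n m) (ContinuousMap.continuous_postcomp L)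
    h1 fun g hg => by
      change IsDeepNet σ (n + m + 2) n m _
      convert IsDeepNet.affine_comp hg B 0 using 1
      funext x
      simp [L]
  convert h2 using 1
  ext x p
  have hA (q : Fin n) : A.mulVec x (i q) = x q := by
    simp [A, Matrix.mulVec, dotProduct, Pi.single_apply, hi.eq_iff]
  have hA' : A.mulVec x (j p) = 0 := by
    simp [A, Matrix.mulVec, dotProduct, Pi.single_apply, fun q => (hij q p).symm]
  have hB (v : Fin (n + m + 1) → ℝ) : L v p = v (j p) := by
    simp [L, B, Matrix.mulVec]
  rw [hG, ContinuousMap.comp_apply, ContinuousMap.comp_apply, hB]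
  simp [T, hA, hA', Fintype.sum_prod_type, Pi.single_apply, hj.eq_iff]

theorem stmt13 {n₀ : ℕ} (Xs : Fin n₀ → Type*)
    [∀ p, MetricSpace (Xs p)] [∀ p, CompactSpace (Xs p)]
    (M : ℕ)
    (ψ : (p : Fin n₀) → Fin (2 * M + 1) → Xs p → ℝ)
    (hψc : ∀ p q, Continuous (ψ p q))
    (hψr : ∀ p q, ∀ t : Xs p, ψ p q t ∈ Set.Icc (0 : ℝ) 1)
    (s : Fin (2 * M + 1) → (∀ p, Xs p) → ℝ)
    (hs : ∀ q x, s q x = ∑ p, ψ p q (x p))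
    (hrep : ∀ f : (∀ p, Xs p) → ℝ, Continuous f →
      ∃ h : Fin (2 * M + 1) → ℝ → ℝ, (∀ q, Continuous (h q)) ∧
        ∀ x, f x = ∑ q, h q (s q x))
    (σ : ℝ → ℝ) (hσc : Continuous σ)
    (hσna : ¬ ∃ a b : ℝ, ∀ t, σ t = a * t + b)
    (hσd : ∃ (t₀ : ℝ) (U : Set ℝ), IsOpen U ∧ t₀ ∈ U ∧
      (∀ t ∈ U, DifferentiableAt ℝ σ t) ∧ ContinuousAt (deriv σ) t₀ ∧ deriv σ t₀ ≠ 0)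
    (F : (∀ p, Xs p) → (Fin (2 * M + 1) → ℝ)) (hF : F = fun x q => s q x)
    (m : ℕ) (hm : 1 ≤ m)
    (K : Set (∀ p, Xs p)) (hK : IsCompact K)
    (g : C(K, EuclideanSpace ℝ (Fin m)))
    (ε : ℝ) (hε : 0 < ε) :
    ∃ Φ : (Fin (2 * M + 1) → ℝ) → (Fin m → ℝ),
      IsDeepNet σ (2 * M + m + 3) (2 * M + 1) m Φ ∧
      ∀ x : K,
        ‖g x - (EuclideanSpace.equiv (Fin m) ℝ).symm (Φ (F (x : ∀ p, Xs p)))‖ < ε := by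
  obtain ⟨t₀, U, -, ht₀, hdiff, -, hne⟩ := hσd
  have hs' (q) : Continuous (s q) := by
    simp only [funext (hs q)]
    fun_prop
  have hFc : Continuous F := hF ▸ continuous_pi hs'
  have hext (p : Fin m) : ∃ h : Fin (2 * M + 1) → C(ℝ, ℝ), ∀ x : K, g x p = ∑ q, h q (s q x) := by
    obtain ⟨f, hf⟩ := ContinuousMap.exists_restrict_eq hK.isClosed
      (⟨fun x => g x p, by fun_prop⟩ : C(K, ℝ))
    obtain ⟨h, hc, hh⟩ := hrep f f.continuous
    exact ⟨fun q => ⟨h q, hc q⟩, fun x => (DFunLike.congr_fun hf x).symm.trans (hh x)⟩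
  choose h hh using hext
  let G : C(Fin (2 * M + 1) → ℝ, Fin m → ℝ) := ⟨fun y p => ∑ q, h p q (y q), by fun_prop⟩
  have hG := sum_mem_closure_netMaps (σ := ⟨σ, hσc⟩) hσna (hdiff t₀ ht₀) hne
    (Nat.le_add_left 1 (2 * M)) hm (fun q p => h p q) G fun _ _ => rfl
  let E : C(Fin m → ℝ, EuclideanSpace ℝ (Fin m)) :=
    ⟨(EuclideanSpace.equiv (Fin m) ℝ).symm, (EuclideanSpace.equiv (Fin m) ℝ).symm.continuous⟩
  obtain ⟨_, ⟨Φ, hΦ, rfl⟩, hd⟩ := mem_closure_iff_forall_isCompact.1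
    (map_mem_closure (ContinuousMap.continuous_postcomp E) hG (Set.mapsTo_image _ _))
    _ (hK.image hFc) ε hε
  refine ⟨Φ, ?_, fun x => ?_⟩
  · have hw : 2 * M + 1 + m + 2 = 2 * M + m + 3 := by omega
    exact hw ▸ hΦ
  · have hx : g x = E (G (F x)) := by
      ext p
      simp [E, G, hF, hh]
    rw [hx, ← dist_eq_norm]
    exact hd _ ⟨x, x.2, rfl⟩
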